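/- Let (a_1,…,a_m) and (b_1,…,b_n) be (possibly empty) sequences of nonzero integers of even length. Then C(a_1,…,a_m) ≤ C(b_1,…,b_n) (i.e. there is a local map from C(a_1,…,a_m) to C(b_1,…,b_n)) if and only if (a_1,…,a_m) ≤^! (b_1,…,b_n) in the lexicographic order induced by the order ≤^! on the integers, padding the shorter sequence with trailing zeros. That is, standard complexes are ordered lexicographically with respect to the total order ≤ on local equivalence classes. -/

import Mathlib

/-!
Common setup: the ring `R = 𝔽₂[U,V]/(UV = 0)`, bigraded free finitely generated chain
complexes over `R` ("pre-complexes"), knot-like complexes, local maps and local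
equivalence, standard and semistandard complexes, short maps, the `Z^!` order,
the invariants `a_i`, `φ_j`, `P`, shift maps, tensor products, duals, and direct sums.
-/

set_option synthInstance.maxHeartbeats 1000000
set_option maxHeartbeats 1000000

noncomputable section

/-- The polynomial ring `𝔽₂[U,V]`. -/
abbrev PolyUV : Type := MvPolynomial (Fin 2) (ZMod 2)

/-- The ideal `(U·V)`. -/
def IUV : Ideal PolyUV := Ideal.span {(MvPolynomial.X 0 * MvPolynomial.X 1 : PolyUV)}

/-- The ring `R = 𝔽₂[U,V]/(UV = 0)`. -/
abbrev RUV : Type := PolyUV ⧸ IUV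

instance : CommRing RUV := Ideal.Quotient.commRing IUV

/-- The image of `U` in `R`. -/
def Uv : RUV := Ideal.Quotient.mk IUV (MvPolynomial.X 0)

/-- The image of `V` in `R`. -/
def Vv : RUV := Ideal.Quotient.mk IUV (MvPolynomial.X 1)

/-- `r ∈ R` is homogeneous of bidegree `(p, q)` for the bigrading with
`gr(U) = (-2, 0)`, `gr(V) = (0, -2)`, `gr(1) = (0, 0)` (coefficients in `𝔽₂`). -/
def IsHomog (r : RUV) (p q : ℤ) : Prop :=
  r = 0 ∨ (∃ a : ℕ, r = Uv ^ a ∧ p = -(2 * (a : ℤ)) ∧ q = 0) ∨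
    (∃ b : ℕ, r = Vv ^ b ∧ p = 0 ∧ q = -(2 * (b : ℤ)))

/-- A finitely generated free bigraded module over `R` with a distinguished basis
indexed by `Fin n`, together with a bigrading `gr` on the basis and a matrix `dm`
recording a prospective differential: `dm i j` is the coefficient of the `j`-th basis
vector in the differential of the `i`-th basis vector. -/
structure PreCx where
  n : ℕ
  gr : Fin n → ℤ × ℤ
  dm : Fin n → Fin n → RUV

/-- The underlying free `R`-module of a pre-complex. -/
abbrev Msub (C : PreCx) : Type := Fin C.n →₀ RUV

/-- The differential of a pre-complex, as an `R`-linear map. -/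
def dmap (C : PreCx) : Msub C →ₗ[RUV] Msub C :=
  Finsupp.linearCombination RUV fun i => ∑ j, Finsupp.single j (C.dm i j)

/-- The submodule `U·C ⊆ C`; `C/U` is the quotient by this submodule. -/
def uSub (C : PreCx) : Submodule RUV (Msub C) :=
  LinearMap.range (LinearMap.lsmul RUV (Msub C) Uv)

/-- The submodule `V·C ⊆ C`; `C/V` is the quotient by this submodule. -/
def vSub (C : PreCx) : Submodule RUV (Msub C) :=
  LinearMap.range (LinearMap.lsmul RUV (Msub C) Vv)

/-- Chains which die in the homology of `C/U`: the preimage in `C` of the boundaries of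
the induced differential on `C/U`. -/
def bdryU (C : PreCx) : Submodule RUV (Msub C) := uSub C ⊔ LinearMap.range (dmap C)

/-- Chains which die in the homology of `C/V`. -/
def bdryV (C : PreCx) : Submodule RUV (Msub C) := vSub C ⊔ LinearMap.range (dmap C)

/-- A chain `x ∈ C` is homogeneous of bidegree `(p, q)`. -/
def ChainHomog (C : PreCx) (x : Msub C) (p q : ℤ) : Prop :=
  ∀ j, IsHomog (x j) (p - (C.gr j).1) (q - (C.gr j).2)

/-- `x` is a `V`-tower class generator: its class in `H_*(C/U)` is a `V`-nontorsion cycle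
whose image generates `H_*(C/U)/(V-torsion)` (equivalently, it is maximally `V`-graded
among `V`-nontorsion classes). -/
def IsVTowerGen (C : PreCx) (x : Msub C) : Prop :=
  dmap C x ∈ uSub C ∧ (∀ k : ℕ, Vv ^ k • x ∉ bdryU C) ∧
    ∀ z : Msub C, dmap C z ∈ uSub C →
      ∃ (r : RUV) (k : ℕ), Vv ^ k • (z - r • x) ∈ bdryU C

/-- `x` is a `U`-tower class generator: its class in `H_*(C/V)` is a `U`-nontorsion cycle
whose image generates `H_*(C/V)/(U-torsion)`. -/
def IsUTowerGen (C : PreCx) (x : Msub C) : Prop :=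
  dmap C x ∈ vSub C ∧ (∀ k : ℕ, Uv ^ k • x ∉ bdryV C) ∧
    ∀ z : Msub C, dmap C z ∈ vSub C →
      ∃ (r : RUV) (k : ℕ), Uv ^ k • (z - r • x) ∈ bdryV C

/-- `C` is a chain complex over `R` whose differential has degree `(-1, -1)`. -/
def IsCplx (C : PreCx) : Prop :=
  (∀ x, dmap C (dmap C x) = 0) ∧
    ∀ i j, IsHomog (C.dm i j) ((C.gr i).1 - 1 - (C.gr j).1) ((C.gr i).2 - 1 - (C.gr j).2)

/-- A knot-like complex: a free, finitely generated, bigraded chain complex over `R`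
whose differential has degree `(-1,-1)`, such that `H_*(C/U)/(V`-torsion`) ≅ 𝔽₂[V]` with
all `V`-nontorsion elements of `H_*(C/U)` in `U`-grading `0`, and
`H_*(C/V)/(U`-torsion`) ≅ 𝔽₂[U]` with all `U`-nontorsion elements of `H_*(C/V)` in
`V`-grading `0`. -/
structure IsKnotLike (C : PreCx) : Prop where
  dsq : ∀ x, dmap C (dmap C x) = 0
  dhomog : ∀ i j, IsHomog (C.dm i j)
    ((C.gr i).1 - 1 - (C.gr j).1) ((C.gr i).2 - 1 - (C.gr j).2)
  vTowerExists : ∃ x, IsVTowerGen C x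
  vTowerGr : ∀ x p q, ChainHomog C x p q → dmap C x ∈ uSub C →
    (∀ k : ℕ, Vv ^ k • x ∉ bdryU C) → p = 0
  uTowerExists : ∃ x, IsUTowerGen C x
  uTowerGr : ∀ x p q, ChainHomog C x p q → dmap C x ∈ vSub C →
    (∀ k : ℕ, Uv ^ k • x ∉ bdryV C) → q = 0

/-- A module map `f : C₁ → C₂` is homogeneous of bidegree `(s, t)`. -/
def MapHomogShift (C₁ C₂ : PreCx) (f : Msub C₁ →ₗ[RUV] Msub C₂) (s t : ℤ) : Prop :=
  ∀ i j, IsHomog (f (Finsupp.single i 1) j)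
    ((C₁.gr i).1 + s - (C₂.gr j).1) ((C₁.gr i).2 + t - (C₂.gr j).2)

/-- A local map `f : C₁ → C₂`: an absolutely `U`-graded, relatively `V`-graded,
`R`-equivariant chain map inducing an isomorphism on `H_*(·/U)/(V-torsion)`
(equivalently, taking `V`-tower generators to `V`-tower generators). -/
structure IsLocalMap (C₁ C₂ : PreCx) (f : Msub C₁ →ₗ[RUV] Msub C₂) : Prop where
  chain : ∀ x, f (dmap C₁ x) = dmap C₂ (f x)
  graded : ∃ s : ℤ, MapHomogShift C₁ C₂ f 0 s
  towers : ∀ x, IsVTowerGen C₁ x → IsVTowerGen C₂ (f x)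

/-- `C₁ ≤ C₂`: there exists a local map `C₁ → C₂`. -/
def LocalLE (C₁ C₂ : PreCx) : Prop := ∃ f, IsLocalMap C₁ C₂ f

/-- Local equivalence of complexes: local maps in both directions. -/
def LocalEquiv (C₁ C₂ : PreCx) : Prop := LocalLE C₁ C₂ ∧ LocalLE C₂ C₁

/-- `C` is reduced: `∂ ≡ 0 mod (U, V)`. -/
def Reduced (C : PreCx) : Prop := ∀ i j, C.dm i j ∈ Ideal.span ({Uv, Vv} : Set RUV)

/-! ### Standard complexes -/

/-- The shift in bigrading from `x_k` to `x_{k+1}` in a standard complex, where the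
parameter joining them is `b` (`k` is the 0-based index of the parameter, so the
parameter is a `U`-power arrow if `k` is even and a `V`-power arrow if `k` is odd). -/
def stepShift (k : ℕ) (b : ℤ) : ℤ × ℤ :=
  if k % 2 = 0 then
    if b < 0 then (2 * (b.natAbs : ℤ) - 1, -1) else (1 - 2 * (b.natAbs : ℤ), 1)
  else
    if b < 0 then (-1, 2 * (b.natAbs : ℤ) - 1) else (1, 1 - 2 * (b.natAbs : ℤ))

/-- Bigrading of `x_i` relative to `x_0` in the standard complex with parameters `L`. -/
def grRel (L : List ℤ) (i : ℕ) : ℤ × ℤ :=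
  ∑ k ∈ Finset.range i, stepShift k (L.getD k 0)

/-- The bigrading of the standard complex of parameters `L`, normalized so that
`gr_U(x_0) = 0` and `gr_V(x_n) = 0`. -/
def stdGr (L : List ℤ) (i : Fin (L.length + 1)) : ℤ × ℤ :=
  ((grRel L (i : ℕ)).1, (grRel L (i : ℕ)).2 - (grRel L L.length).2)

/-- The differential matrix of the standard complex of parameters `L = (b_1, …, b_n)`:
for `i` odd (1-based), `∂_U x_{i-1} = U^{|b_i|} x_i` if `b_i < 0` and
`∂_U x_i = U^{b_i} x_{i-1}` if `b_i > 0`; for `i` even the same with `V` in place of `U`;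
all other differentials vanish. -/
def stdDm (L : List ℤ) (i j : Fin (L.length + 1)) : RUV :=
  if (j : ℕ) = (i : ℕ) + 1 ∧ L.getD (i : ℕ) 0 < 0 then
    (if (i : ℕ) % 2 = 0 then Uv else Vv) ^ (L.getD (i : ℕ) 0).natAbs
  else if (i : ℕ) = (j : ℕ) + 1 ∧ 0 < L.getD (j : ℕ) 0 then
    (if (j : ℕ) % 2 = 0 then Uv else Vv) ^ (L.getD (j : ℕ) 0).natAbs
  else 0

/-- The standard complex `C(b_1, …, b_n)` of a list of parameters `L = (b_1, …, b_n)`,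
with generators `x_0, …, x_n`.  (For `L = []` this is the trivial complex `R`.) -/
def StdCx (L : List ℤ) : PreCx := ⟨L.length + 1, stdGr L, stdDm L⟩

/-- `L` is a valid parameter sequence for a standard complex: all entries are nonzero
and the length is even (possibly zero). -/
def IsStdSeq (L : List ℤ) : Prop := (∀ b ∈ L, b ≠ 0) ∧ Even L.length

/-- The trivial standard complex `C(0) = R`. -/
def trivCx : PreCx := StdCx []

/-- The bigrading of the semistandard complex `C'(b_1, …, b_n)` (`n` odd), inherited from
the ambient standard complex `C(b_1, …, b_n, 1)`. -/
def semiGr (L : List ℤ) (i : Fin (L.length + 1)) : ℤ × ℤ :=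
  ((grRel L (i : ℕ)).1, (grRel L (i : ℕ)).2 - (grRel L L.length).2 + 1)

/-- The semistandard complex `C'(b_1, …, b_n)` (`n` odd): the subcomplex of
`C(b_1, …, b_n, 1)` generated by `x_0, …, x_n`. -/
def SemiStdCx (L : List ℤ) : PreCx := ⟨L.length + 1, semiGr L, stdDm L⟩

/-! ### Tensor products, duals, direct sums -/

/-- The tensor product (over `R`) of two pre-complexes, with basis `x_i ⊗ y_j` and
differential `∂(x ⊗ y) = ∂x ⊗ y + x ⊗ ∂y` (signs are irrelevant in characteristic 2). -/
def tensorCx (C₁ C₂ : PreCx) : PreCx where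
  n := C₁.n * C₂.n
  gr := fun p => C₁.gr (finProdFinEquiv.symm p).1 + C₂.gr (finProdFinEquiv.symm p).2
  dm := fun p q =>
    (if (finProdFinEquiv.symm p).2 = (finProdFinEquiv.symm q).2 then
      C₁.dm (finProdFinEquiv.symm p).1 (finProdFinEquiv.symm q).1 else 0) +
    (if (finProdFinEquiv.symm p).1 = (finProdFinEquiv.symm q).1 then
      C₂.dm (finProdFinEquiv.symm p).2 (finProdFinEquiv.symm q).2 else 0)

/-- The dual complex `C^∨ = Hom_R(C, R)`, described on the dual basis: the gradings are
negated and the differential matrix is transposed. -/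
def dualCx (C : PreCx) : PreCx := ⟨C.n, fun i => -C.gr i, fun i j => C.dm j i⟩

/-- The direct sum of two pre-complexes. -/
def sumCx (C₁ C₂ : PreCx) : PreCx where
  n := C₁.n + C₂.n
  gr := fun p => Sum.elim C₁.gr C₂.gr (finSumFinEquiv.symm p)
  dm := fun p q =>
    match finSumFinEquiv.symm p, finSumFinEquiv.symm q with
    | Sum.inl i, Sum.inl k => C₁.dm i k
    | Sum.inr j, Sum.inr l => C₂.dm j l
    | _, _ => 0

/-- A homotopy equivalence of bigraded chain complexes over `R`: chain maps `f, g`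
preserving the bigrading, with `g ∘ f ≃ id` and `f ∘ g ≃ id` via `R`-equivariant
homotopies of bidegree `(1, 1)`. -/
def HomotopyEquivCx (C₁ C₂ : PreCx) : Prop :=
  ∃ (f : Msub C₁ →ₗ[RUV] Msub C₂) (g : Msub C₂ →ₗ[RUV] Msub C₁)
    (H : Msub C₁ →ₗ[RUV] Msub C₁) (K : Msub C₂ →ₗ[RUV] Msub C₂),
    (∀ x, f (dmap C₁ x) = dmap C₂ (f x)) ∧
    (∀ y, g (dmap C₂ y) = dmap C₁ (g y)) ∧
    MapHomogShift C₁ C₂ f 0 0 ∧ MapHomogShift C₂ C₁ g 0 0 ∧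
    MapHomogShift C₁ C₁ H 1 1 ∧ MapHomogShift C₂ C₂ K 1 1 ∧
    (∀ x, g (f x) - x = dmap C₁ (H x) + H (dmap C₁ x)) ∧
    (∀ y, f (g y) - y = dmap C₂ (K y) + K (dmap C₂ y))

/-- An isomorphism of bigraded chain complexes over `R`. -/
def IsBigradedChainIso (C₁ C₂ : PreCx) (f : Msub C₁ →ₗ[RUV] Msub C₂) : Prop :=
  Function.Bijective f ∧ (∀ x, f (dmap C₁ x) = dmap C₂ (f x)) ∧ MapHomogShift C₁ C₂ f 0 0

/-! ### Short maps -/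

/-- A short map `f : C(b_1, …, b_n) ⇝ C`: an absolutely `U`-graded, relatively
`V`-graded `R`-module map which is a chain map at `x_1, …, x_{n-1}` and commutes with
the `V`-part of the differential at `x_n` (for reduced `C`, the failure
`∂ f(x_n) - f(∂_V x_n)` is exactly `∂_U f(x_n) ∈ U·C`). -/
def IsShortMap (L : List ℤ) (C : PreCx) (f : Msub (StdCx L) →ₗ[RUV] Msub C) : Prop :=
  (∃ s : ℤ, MapHomogShift (StdCx L) C f 0 s) ∧
  (∀ i : Fin (L.length + 1), 1 ≤ (i : ℕ) → (i : ℕ) + 1 ≤ L.length →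
    f (dmap (StdCx L) (Finsupp.single i 1)) = dmap C (f (Finsupp.single i 1))) ∧
  dmap C (f (Finsupp.single (Fin.last L.length) 1)) -
    f (dmap (StdCx L) (Finsupp.single (Fin.last L.length) 1)) ∈ uSub C

/-- A short local map: a short map sending the `V`-tower generator `x_0` to a `V`-tower
generator (hence inducing an isomorphism on `H_*(·/U)/(V-torsion)`). -/
def IsShortLocalMap (L : List ℤ) (C : PreCx) (f : Msub (StdCx L) →ₗ[RUV] Msub C) : Prop :=
  IsShortMap L C f ∧ IsVTowerGen C (f (Finsupp.single (0 : Fin (L.length + 1)) 1))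

/-- A local map from the semistandard complex `C'(b_1, …, b_n)` to a knot-like complex:
a grading-preserving `R`-equivariant chain map under which the class of `x_0`
generates `H_*(C/U)/(V-torsion)`. -/
def IsSemiLocalMap (L : List ℤ) (C : PreCx) (f : Msub (SemiStdCx L) →ₗ[RUV] Msub C) : Prop :=
  (∀ x, f (dmap (SemiStdCx L) x) = dmap C (f x)) ∧
  MapHomogShift (SemiStdCx L) C f 0 0 ∧
  IsVTowerGen C (f (Finsupp.single (0 : Fin (L.length + 1)) 1))

/-! ### The order `Z^!` and the numerical invariants -/

/-- The embedding of `Z^!` into `ℚ` realizing the order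
`-1 <^! -2 <^! ⋯ <^! 0 <^! ⋯ <^! 2 <^! 1`: send `0 ↦ 0` and `a ↦ 1/a` otherwise. -/
def qval (a : ℤ) : ℚ := if a = 0 then 0 else 1 / (a : ℚ)

/-- The order `≤^!` on `Z^!`. -/
def bangLE (a b : ℤ) : Prop := qval a ≤ qval b

/-- Pad a finite sequence with trailing zeros. -/
def seqPad (L : List ℤ) (i : ℕ) : ℤ := L.getD i 0

/-- The lexicographic order on finite integer sequences induced by `≤^!`, padding the
shorter sequence with trailing zeros. -/
def bangLexLE (L₁ L₂ : List ℤ) : Prop :=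
  (∀ i, seqPad L₁ i = seqPad L₂ i) ∨
    ∃ k, (∀ i < k, seqPad L₁ i = seqPad L₂ i) ∧ qval (seqPad L₁ k) < qval (seqPad L₂ k)

/-- `m` is an upper bound for `S ⊆ Z^!` with respect to `≤^!`. -/
def IsBangUB (S : Set ℤ) (m : ℤ) : Prop := ∀ b ∈ S, qval b ≤ qval m

/-- `m = sup^! S`, the least upper bound of `S ⊆ Z^!` with respect to `≤^!`. -/
def IsBangLUB (S : Set ℤ) (m : ℤ) : Prop :=
  IsBangUB S m ∧ ∀ m' : ℤ, IsBangUB S m' → qval m ≤ qval m'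

/-- Candidate set for the next invariant: given the already-constructed prefix `P`,
those nonzero `b` such that some standard complex `C(P, b, rest) ≤ C`. -/
def candSet (C : PreCx) (P : List ℤ) : Set ℤ :=
  {b | b ≠ 0 ∧ ∃ rest : List ℤ, IsStdSeq (P ++ b :: rest) ∧ LocalLE (StdCx (P ++ b :: rest)) C}

/-- `a` is the sequence of numerical invariants `a_i(C)` (indexed from `0`):
once a term vanishes all later terms vanish, and otherwise each term is
`sup^!` of the corresponding candidate set. -/
def InvSeq (C : PreCx) (a : ℕ → ℤ) : Prop :=
  ∀ k : ℕ,
    ((∃ i < k, a i = 0) → a k = 0) ∧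
    ((∀ i < k, a i ≠ 0) → IsBangLUB (candSet C ((List.range k).map a)) (a k))

/-- The first `n` terms of `a`, with the (all-zero) tail deleted. -/
def truncSeq (a : ℕ → ℤ) (n : ℕ) : List ℤ :=
  ((List.range n).map a).takeWhile (fun b => b != 0)

/-! ### The homomorphisms `φ_j`, `P` and the shifts `sh_m` -/

/-- `φ_j` of a standard complex `C(a_1, …, a_n)`: the signed count
`#{i odd : a_i = j} − #{i odd : a_i = −j}` (with 1-based odd `i`). -/
def phi (j : ℕ) (L : List ℤ) : ℤ :=
  ∑ i ∈ Finset.range L.length,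
    if i % 2 = 0 then
      (if L.getD i 0 = (j : ℤ) then 1 else 0) - (if L.getD i 0 = -(j : ℤ) then 1 else 0)
    else 0

/-- The shift `sh_m` on parameter sequences: entries of absolute value `≥ m` are pushed
one further from zero; entries of absolute value `< m` are fixed. -/
def shSeq (m : ℕ) (L : List ℤ) : List ℤ :=
  L.map fun a => if (m : ℤ) ≤ a then a + 1 else if a ≤ -(m : ℤ) then a - 1 else a

/-- `P(C) = -2 ∑_{j>0} j φ_j(C) + ∑_i sgn a_i`, computed from the parameter sequence of
the standard representative (the sum over `j` is finite since `φ_j` vanishes for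
`j` larger than any `|a_i|`). -/
def Pval (L : List ℤ) : ℤ :=
  -2 * (∑ j ∈ Finset.range ((L.map Int.natAbs).sum + 1), (j : ℤ) * phi j L) +
    (L.map Int.sign).sum

end

noncomputable section

/-- The variable labelling the `k`-th arrow of a standard complex. -/
def stepVar (k : ℕ) : RUV := if k % 2 = 0 then Uv else Vv

lemma Uv_mul_Vv : Uv * Vv = 0 := by
  rw [Uv, Vv, ← map_mul]
  exact Ideal.Quotient.eq_zero_iff_mem.2 (Ideal.subset_span rfl)

/-- The projection `R → 𝔽₂[X]` sending the variable of the `k`-th arrow to `X` and the other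
variable to `0`. -/
def stepProj (k : ℕ) : RUV →+* Polynomial (ZMod 2) :=
  Ideal.Quotient.lift IUV
    (MvPolynomial.eval₂Hom Polynomial.C
      fun i : Fin 2 => if (i : ℕ) = k % 2 then Polynomial.X else 0) <| by
    have h : IUV ≤ RingHom.ker (MvPolynomial.eval₂Hom (Polynomial.C : ZMod 2 →+* _)
        fun i : Fin 2 => if (i : ℕ) = k % 2 then Polynomial.X else 0) := by
      rw [IUV, Ideal.span_le, Set.singleton_subset_iff]
      rcases Nat.mod_two_eq_zero_or_one k with h | h <;> simp [RingHom.mem_ker, h]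
    exact fun a ha => h ha

lemma stepProj_mk_C (k : ℕ) (a : ZMod 2) :
    stepProj k (Ideal.Quotient.mk IUV (MvPolynomial.C a)) = Polynomial.C a :=
  (Ideal.Quotient.lift_mk _ _ _).trans (MvPolynomial.eval₂_C _ _ _)

lemma stepProj_mk_X (k : ℕ) (i : Fin 2) :
    stepProj k (Ideal.Quotient.mk IUV (MvPolynomial.X i)) =
      if (i : ℕ) = k % 2 then Polynomial.X else 0 :=
  (Ideal.Quotient.lift_mk _ _ _).trans (MvPolynomial.eval₂_X _ _ _)

lemma stepProj_congr {k l : ℕ} (h : k % 2 = l % 2) : stepProj k = stepProj l := by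
  simp only [stepProj, h]

lemma stepProj_Uv (k : ℕ) : stepProj k Uv = if k % 2 = 0 then Polynomial.X else 0 := by
  simp [Uv, stepProj_mk_X, eq_comm]

lemma stepProj_Vv (k : ℕ) : stepProj k Vv = if k % 2 = 1 then Polynomial.X else 0 := by
  simp [Vv, stepProj_mk_X, eq_comm]

lemma stepProj_stepVar (k l : ℕ) :
    stepProj k (stepVar l) = if k % 2 = l % 2 then Polynomial.X else 0 := by
  unfold stepVar
  split_ifs <;> simp [stepProj_Uv, stepProj_Vv] <;> omega

lemma stepVar_mul_stepVar_succ (k : ℕ) : stepVar k * stepVar (k + 1) = 0 := by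
  have h : (k + 1) % 2 = 0 ↔ ¬ k % 2 = 0 := by omega
  by_cases hk : k % 2 = 0
  · simp [stepVar, h, hk, Uv_mul_Vv]
  · simp [stepVar, h, hk, mul_comm Vv, Uv_mul_Vv]

lemma stepProj_one_surjective : Function.Surjective (stepProj 1) := by
  intro p
  refine ⟨p.eval₂ ((Ideal.Quotient.mk IUV).comp MvPolynomial.C) Vv, ?_⟩
  rw [Polynomial.hom_eval₂, stepProj_Vv, if_pos rfl]
  convert Polynomial.eval₂_C_X (p := p)
  ext; simp [stepProj_mk_C]

lemma Uv_dvd_of_stepProj_one_eq_zero {r : RUV} (h : stepProj 1 r = 0) : Uv ∣ r := by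
  let s : Polynomial (ZMod 2) →+* RUV :=
    Polynomial.eval₂RingHom ((Ideal.Quotient.mk IUV).comp MvPolynomial.C) Vv
  have key : ∀ p : PolyUV, Uv ∣ Ideal.Quotient.mk IUV p
      - s (stepProj 1 (Ideal.Quotient.mk IUV p)) := by
    intro p
    induction p using MvPolynomial.induction_on with
    | C a => simp [stepProj_mk_C, s]
    | add p q hp hq =>
      simp only [map_add]
      rw [add_sub_add_comm]
      exact dvd_add hp hq
    | mul_X p i hp =>
      have hi : Uv ∣ Ideal.Quotient.mk IUV (MvPolynomial.X i)
          - s (stepProj 1 (Ideal.Quotient.mk IUV (MvPolynomial.X i))) := by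
        fin_cases i
        · change Uv ∣ Uv - s (stepProj 1 Uv)
          simp [stepProj_Uv]
        · change Uv ∣ Vv - s (stepProj 1 Vv)
          simp [stepProj_Vv, s]
      simp only [map_mul]
      exact dvd_mul_sub_mul hp hi
  obtain ⟨p, rfl⟩ := Ideal.Quotient.mk_surjective r
  simpa [h] using key p

lemma coeff_zero_stepProj (k l : ℕ) (r : RUV) :
    (stepProj k r).coeff 0 = (stepProj l r).coeff 0 := by
  obtain ⟨p, rfl⟩ := Ideal.Quotient.mk_surjective r
  induction p using MvPolynomial.induction_on with
  | C a => simp [stepProj_mk_C]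
  | add p q hp hq => simp only [map_add, Polynomial.coeff_add, hp, hq]
  | mul_X p i hp =>
    simp only [map_mul, Polynomial.mul_coeff_zero, hp]
    congr 1
    rw [stepProj_mk_X, stepProj_mk_X]
    split_ifs <;> simp

/-- The `i`-th generator of a standard complex, or `0` if `i` is out of range. -/
def stdBasis (L : List ℤ) (i : ℕ) : Msub (StdCx L) :=
  if h : i < (StdCx L).n then Finsupp.single ⟨i, h⟩ 1 else 0

/-- The `j`-th coordinate on a standard complex, or `0` if `j` is out of range. -/
def stdCoord (L : List ℤ) (j : ℕ) : Msub (StdCx L) →ₗ[RUV] RUV :=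
  if h : j < (StdCx L).n then Finsupp.lapply ⟨j, h⟩ else 0

lemma StdCx_n (L : List ℤ) : (StdCx L).n = L.length + 1 := rfl

lemma stdBasis_val (L : List ℤ) (i : Fin (StdCx L).n) :
    stdBasis L i = Finsupp.single i 1 := by simp [stdBasis, i.2]

lemma stdCoord_val (L : List ℤ) (j : Fin (StdCx L).n) (x : Msub (StdCx L)) :
    stdCoord L j x = x j := by
  have : stdCoord L j = Finsupp.lapply j := by
    simp only [stdCoord, j.2, dite_true]
  rw [this]; rfl

lemma stdCoord_single (L : List ℤ) (i : Fin (StdCx L).n) (r : RUV) (j : ℕ) :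
    stdCoord L j (Finsupp.single i r) = if (i : ℕ) = j then r else 0 := by
  by_cases hj : j < (StdCx L).n
  · rw [stdCoord_val L ⟨j, hj⟩, Finsupp.single_apply]
    simp only [Fin.ext_iff]
  · rw [if_neg fun h : (i : ℕ) = j => hj (h ▸ i.2)]
    simp [stdCoord, hj]

lemma stdCoord_stdBasis (L : List ℤ) {i : ℕ} (hi : i ≤ L.length) (j : ℕ) :
    stdCoord L j (stdBasis L i) = if i = j then 1 else 0 := by
  rw [stdBasis_val L ⟨i, Nat.lt_succ_of_le hi⟩, stdCoord_single]

lemma seqPad_eq_zero {L : List ℤ} {k : ℕ} (h : L.length ≤ k) : seqPad L k = 0 :=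
  List.getD_eq_default _ _ h

lemma seqPad_ne_zero {L : List ℤ} (hL : IsStdSeq L) {k : ℕ} (h : k < L.length) :
    seqPad L k ≠ 0 := by
  rw [seqPad, List.getD_eq_getElem _ _ h]
  exact hL.1 _ (List.getElem_mem h)

lemma lt_length_of_seqPad_ne_zero {L : List ℤ} {k : ℕ} (h : seqPad L k ≠ 0) : k < L.length := by
  by_contra hk
  exact h (seqPad_eq_zero (by omega))

lemma dmap_single_apply (C : PreCx) (i j : Fin C.n) (r : RUV) :
    dmap C (Finsupp.single i r) j = r * C.dm i j := by
  simp [dmap, Finsupp.linearCombination_single, Finsupp.single_apply]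

lemma StdCx_dm (L : List ℤ) (i j : Fin (StdCx L).n) :
    (StdCx L).dm i j = if (j : ℕ) = i + 1 ∧ seqPad L i < 0 then stepVar i ^ (seqPad L i).natAbs
      else if (i : ℕ) = j + 1 ∧ 0 < seqPad L j then stepVar j ^ (seqPad L j).natAbs else 0 :=
  rfl

lemma stdCoord_dmap_stdBasis (L : List ℤ) (i j : Fin (StdCx L).n) :
    stdCoord L j (dmap (StdCx L) (stdBasis L i)) = (StdCx L).dm i j := by
  rw [stdCoord_val L j, stdBasis_val L i]
  exact (dmap_single_apply (StdCx L) i j 1).trans (one_mul _)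

lemma dmap_stdBasis_zero (L : List ℤ) : dmap (StdCx L) (stdBasis L 0) =
    if seqPad L 0 < 0 then stepVar 0 ^ (seqPad L 0).natAbs • stdBasis L 1 else 0 := by
  refine Finsupp.ext fun j => ?_
  rw [← stdCoord_val L j, ← stdCoord_val L j, stdCoord_dmap_stdBasis L ⟨0, Nat.succ_pos _⟩ j, StdCx_dm]
  simp only [zero_add]
  by_cases h : seqPad L 0 < 0
  · have := lt_length_of_seqPad_ne_zero h.ne
    rw [if_pos h, map_smul, stdCoord_stdBasis L this]
    by_cases hj : (j : ℕ) = 1 <;> simp [h, hj, eq_comm]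
  · simp [h]

lemma dmap_stdBasis_succ (L : List ℤ) (i : ℕ) :
    dmap (StdCx L) (stdBasis L (i + 1)) =
      (if seqPad L (i + 1) < 0 then
        stepVar (i + 1) ^ (seqPad L (i + 1)).natAbs • stdBasis L (i + 2) else 0) +
      if 0 < seqPad L i then stepVar i ^ (seqPad L i).natAbs • stdBasis L i else 0 := by
  by_cases hi : L.length < i + 1
  · rw [seqPad_eq_zero (by omega), seqPad_eq_zero (by omega)]
    simp [show stdBasis L (i + 1) = 0 from dif_neg (by rw [StdCx_n]; omega)]
  rw [not_lt] at hi
  refine Finsupp.ext fun j => ?_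
  rw [← stdCoord_val L j, ← stdCoord_val L j, stdCoord_dmap_stdBasis L ⟨i + 1, Nat.lt_succ_of_le hi⟩ j,
    StdCx_dm, map_add]
  have h₁ : stdCoord L j (if seqPad L (i + 1) < 0 then
        stepVar (i + 1) ^ (seqPad L (i + 1)).natAbs • stdBasis L (i + 2) else 0) =
      if (j : ℕ) = i + 2 ∧ seqPad L (i + 1) < 0 then
        stepVar (i + 1) ^ (seqPad L (i + 1)).natAbs else 0 := by
    by_cases h : seqPad L (i + 1) < 0
    · have := lt_length_of_seqPad_ne_zero h.ne
      simp [h, stdCoord_stdBasis L (i := i + 2) this, eq_comm]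
    · simp [h]
  have h₂ : stdCoord L j (if 0 < seqPad L i then
        stepVar i ^ (seqPad L i).natAbs • stdBasis L i else 0) =
      if i = (j : ℕ) ∧ 0 < seqPad L i then stepVar i ^ (seqPad L i).natAbs else 0 := by
    by_cases h : 0 < seqPad L i
    · simp [h, stdCoord_stdBasis L (i := i) (by omega)]
    · simp [h]
  rw [h₁, h₂]
  by_cases h : (j : ℕ) = i + 2
  · have : i ≠ (j : ℕ) := by omega
    simp [h]
  · by_cases h' : i = (j : ℕ)
    · subst h'
      simp only [h, false_and, if_false, zero_add]
    · simp [h, h']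

lemma stepProj_dmap_tail (L : List ℤ) (k : ℕ) (x : Msub (StdCx L)) :
    stepProj k (stdCoord L k (dmap (StdCx L) x)) =
      if 0 < seqPad L k then
        Polynomial.X ^ (seqPad L k).natAbs * stepProj k (stdCoord L (k + 1) x) else 0 := by
  induction x using Finsupp.induction_linear with
  | zero => simp
  | add x y hx hy =>
    simp only [map_add, hx, hy]
    split_ifs <;> ring
  | single i r =>
    by_cases hk : k < (StdCx L).n
    · rw [stdCoord_val L ⟨k, hk⟩, dmap_single_apply, StdCx_dm, stdCoord_single]
      by_cases h₁ : k = i + 1 ∧ seqPad L i < 0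
      · have h : seqPad L i ≠ 0 := h₁.2.ne
        have h' : (i + 1 : ℕ) % 2 ≠ i % 2 := by omega
        rw [if_pos h₁]
        simp [stepProj_stepVar, h₁.1, h, h', add_assoc]
      · rw [if_neg h₁]
        by_cases h₂ : (i : ℕ) = k + 1 <;> by_cases h₃ : 0 < seqPad L k <;>
          simp [h₂, h₃, stepProj_stepVar, mul_comm]
    · rw [StdCx_n] at hk
      rw [seqPad_eq_zero (by omega)]
      simp [stdCoord, StdCx_n, hk]

lemma stepProj_dmap_head (L : List ℤ) (k : ℕ) (x : Msub (StdCx L)) :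
    stepProj k (stdCoord L (k + 1) (dmap (StdCx L) x)) =
      if seqPad L k < 0 then
        Polynomial.X ^ (seqPad L k).natAbs * stepProj k (stdCoord L k x) else 0 := by
  induction x using Finsupp.induction_linear with
  | zero => simp
  | add x y hx hy =>
    simp only [map_add, hx, hy]
    split_ifs <;> ring
  | single i r =>
    by_cases hk : k + 1 < (StdCx L).n
    · rw [stdCoord_val L ⟨k + 1, hk⟩, dmap_single_apply, StdCx_dm, stdCoord_single]
      by_cases h₁ : (i : ℕ) = k
      · subst h₁
        by_cases h₂ : seqPad L i < 0
        · simp [h₂, stepProj_stepVar, mul_comm]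
        · simp [h₂, add_assoc]
      · rw [if_neg fun h => h₁ (Nat.succ_injective h.1).symm]
        by_cases h₂ : (i : ℕ) = k + 1 + 1 ∧ 0 < seqPad L (k + 1)
        · have h : seqPad L (k + 1) ≠ 0 := h₂.2.ne'
          have h' : k % 2 ≠ (k + 1) % 2 := by omega
          simp [h₂, stepProj_stepVar, h, h', add_assoc]
        · simp [h₁, h₂]
    · rw [StdCx_n] at hk
      rw [seqPad_eq_zero (by omega)]
      simp [stdCoord, StdCx_n, hk]

lemma stepProj_one_dmap_zero (L : List ℤ) (x : Msub (StdCx L)) :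
    stepProj 1 (stdCoord L 0 (dmap (StdCx L) x)) = 0 := by
  induction x using Finsupp.induction_linear with
  | zero => simp
  | add x y hx hy => simp only [map_add, hx, hy, add_zero]
  | single i r =>
    rw [stdCoord_val L ⟨0, Nat.succ_pos _⟩, dmap_single_apply, StdCx_dm]
    by_cases h : 0 < seqPad L 0
    · simp [h, h.ne', apply_ite (stepProj 1), stepProj_stepVar]
    · simp [h]

lemma mem_uSub_iff (L : List ℤ) (x : Msub (StdCx L)) :
    x ∈ uSub (StdCx L) ↔ ∀ j, stepProj 1 (stdCoord L j x) = 0 := by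
  constructor
  · rintro ⟨y, rfl⟩ j
    simp [stepProj_Uv]
  · intro h
    choose f hf using fun j => Uv_dvd_of_stepProj_one_eq_zero (h j)
    refine ⟨Finsupp.equivFunOnFinite.symm fun j => f j, Finsupp.ext fun j => ?_⟩
    have := hf j
    rw [stdCoord_val L j] at this
    simp [this]

lemma stepProj_one_eq_of_mem_bdryU {L : List ℤ} {x : Msub (StdCx L)} (h : x ∈ bdryU (StdCx L)) :
    stepProj 1 (stdCoord L 0 x) = 0 := by
  obtain ⟨y, hy, _, ⟨z, rfl⟩, rfl⟩ := Submodule.mem_sup.1 h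
  rw [map_add, map_add, (mem_uSub_iff L y).1 hy, stepProj_one_dmap_zero, add_zero]

/-- A cycle modulo `U` with vanishing `x_0`-coordinate modulo `U` is `V`-torsion in the homology
of `C/U`. -/
lemma exists_Vv_pow_smul_mem_bdryU {L : List ℤ} (hL : IsStdSeq L) {w : Msub (StdCx L)}
    (hw : dmap (StdCx L) w ∈ uSub (StdCx L)) (hw₀ : stepProj 1 (stdCoord L 0 w) = 0) :
    ∃ k : ℕ, Vv ^ k • w ∈ bdryU (StdCx L) := by
  obtain ⟨N, hN⟩ : ∃ N, ∀ i, (seqPad L i).natAbs ≤ N := by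
    obtain ⟨N, hN⟩ := ((Finset.range L.length).image fun i => (seqPad L i).natAbs).bddAbove
    refine ⟨N, fun i => ?_⟩
    by_cases hi : i < L.length
    · exact hN (by simpa using ⟨i, hi, rfl⟩)
    · simp [seqPad_eq_zero (not_lt.1 hi)]
  let g : ℕ → RUV := fun i =>
    if i % 2 = 1 then
      if seqPad L i < 0 then Vv ^ (N - (seqPad L i).natAbs) * stdCoord L (i + 1) w else 0
    else if 0 < seqPad L (i - 1) then
      Vv ^ (N - (seqPad L (i - 1)).natAbs) * stdCoord L (i - 1) w else 0
  let u : Msub (StdCx L) := Finsupp.equivFunOnFinite.symm fun i => g i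
  have hu : ∀ i ≤ L.length, stdCoord L i u = g i := fun i hi =>
    stdCoord_val L ⟨i, Nat.lt_succ_of_le hi⟩ u
  refine ⟨N, ?_⟩
  rw [← sub_add_cancel (Vv ^ N • w) (dmap _ u)]
  refine Submodule.add_mem_sup ((mem_uSub_iff L _).2 fun j => ?_) ⟨u, rfl⟩
  rw [map_sub, map_sub, sub_eq_zero, map_smul, smul_eq_mul, map_mul, map_pow, stepProj_Vv,
    if_pos rfl]
  have hw' := (mem_uSub_iff L _).1 hw
  have pow_eq (k : ℕ) : (Polynomial.X : Polynomial (ZMod 2)) ^ N =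
      Polynomial.X ^ (seqPad L k).natAbs * Polynomial.X ^ (N - (seqPad L k).natAbs) := by
    rw [← pow_add, Nat.add_sub_cancel' (hN k)]
  rcases Nat.lt_or_ge L.length j with hj | hj
  · simp [stdCoord, StdCx_n, show ¬ j < L.length + 1 by omega]
  rcases Nat.eq_zero_or_pos j with rfl | hj₀
  · rw [hw₀, stepProj_one_dmap_zero, mul_zero]
  obtain ⟨m, hm⟩ := hL.2
  by_cases hjo : j % 2 = 1
  · have hne := seqPad_ne_zero hL (k := j) (by omega)
    have h₁ := hw' (j + 1)
    rw [stepProj_congr (k := 1) (l := j) (by omega)] at h₁ ⊢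
    rw [stepProj_dmap_head] at h₁
    rw [stepProj_dmap_tail, hu (j + 1) (by omega)]
    rcases hne.lt_or_gt with h | h
    · rw [if_pos h, mul_eq_zero_iff_left (pow_ne_zero _ Polynomial.X_ne_zero)] at h₁
      rw [if_neg (by omega), h₁, mul_zero]
    · have hg : g (j + 1) = Vv ^ (N - (seqPad L j).natAbs) * stdCoord L j w := by
        simp only [g, Nat.add_sub_cancel]
        rw [if_neg (by omega), if_pos h]
      rw [if_pos h, hg, map_mul, map_pow, stepProj_Vv, if_pos hjo, pow_eq j, mul_assoc]
  · obtain ⟨k, rfl⟩ : ∃ k, j = k + 1 := ⟨j - 1, by omega⟩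
    have hne := seqPad_ne_zero hL (k := k) (by omega)
    have h₁ := hw' k
    rw [stepProj_congr (k := 1) (l := k) (by omega)] at h₁ ⊢
    rw [stepProj_dmap_tail] at h₁
    rw [stepProj_dmap_head, hu k (by omega)]
    rcases hne.lt_or_gt with h | h
    · have hg : g k = Vv ^ (N - (seqPad L k).natAbs) * stdCoord L (k + 1) w := by
        simp only [g]
        rw [if_pos (by omega), if_pos h]
      rw [if_pos h, hg, map_mul, map_pow, stepProj_Vv, if_pos (by omega), pow_eq k, mul_assoc]
    · rw [if_pos h, mul_eq_zero_iff_left (pow_ne_zero _ Polynomial.X_ne_zero)] at h₁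
      rw [if_neg (by omega), h₁, mul_zero]

lemma isVTowerGen_stdCx_iff {L : List ℤ} (hL : IsStdSeq L) (x : Msub (StdCx L)) :
    IsVTowerGen (StdCx L) x ↔
      dmap (StdCx L) x ∈ uSub (StdCx L) ∧ IsUnit (stepProj 1 (stdCoord L 0 x)) := by
  have coord (k : ℕ) (y : Msub (StdCx L)) : stepProj 1 (stdCoord L 0 (Vv ^ k • y)) =
      Polynomial.X ^ k * stepProj 1 (stdCoord L 0 y) := by
    rw [map_smul, smul_eq_mul, map_mul, map_pow, stepProj_Vv, if_pos rfl]
  constructor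
  · rintro ⟨h₁, -, h₃⟩
    refine ⟨h₁, ?_⟩
    obtain ⟨r, k, h⟩ := h₃ (stdBasis L 0) <| by
      rw [dmap_stdBasis_zero]
      split_ifs with h
      · obtain ⟨n, hn⟩ := Nat.exists_eq_succ_of_ne_zero (Int.natAbs_ne_zero.2 h.ne)
        rw [hn, pow_succ', mul_smul]
        exact ⟨_, rfl⟩
      · exact zero_mem _
    have h := stepProj_one_eq_of_mem_bdryU h
    rw [coord, mul_eq_zero_iff_left (pow_ne_zero _ Polynomial.X_ne_zero), map_sub, map_smul,
      stdCoord_stdBasis L (Nat.zero_le _), if_pos rfl, smul_eq_mul, map_sub, map_one, map_mul,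
      sub_eq_zero, mul_comm] at h
    exact .of_mul_eq_one _ h.symm
  · rintro ⟨h₁, h₂⟩
    refine ⟨h₁, fun k hk => ?_, fun z hz => ?_⟩
    · have h := stepProj_one_eq_of_mem_bdryU hk
      rw [coord] at h
      exact mul_ne_zero (pow_ne_zero _ Polynomial.X_ne_zero) h₂.ne_zero h
    · obtain ⟨y, hy⟩ := h₂.exists_left_inv
      obtain ⟨r, hr⟩ := stepProj_one_surjective (stepProj 1 (stdCoord L 0 z) * y)
      refine ⟨r, exists_Vv_pow_smul_mem_bdryU hL ?_ ?_⟩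
      · rw [map_sub, map_smul]
        exact sub_mem hz (Submodule.smul_mem _ _ h₁)
      · rw [map_sub, map_smul, smul_eq_mul, map_sub, map_mul, hr, mul_assoc, hy, mul_one, sub_self]

lemma stepProj_map_dmap_stdBasis {L : List ℤ} {C : PreCx} (f : Msub (StdCx L) →ₗ[RUV] Msub C)
    (φ : Msub C →ₗ[RUV] RUV) (k : ℕ) :
    stepProj k (φ (f (dmap (StdCx L) (stdBasis L k)))) =
      if seqPad L k < 0 then
        Polynomial.X ^ (seqPad L k).natAbs * stepProj k (φ (f (stdBasis L (k + 1)))) else 0 := by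
  have h₁ : stepProj k (φ (f (if seqPad L k < 0 then
      stepVar k ^ (seqPad L k).natAbs • stdBasis L (k + 1) else 0))) = if seqPad L k < 0 then
        Polynomial.X ^ (seqPad L k).natAbs * stepProj k (φ (f (stdBasis L (k + 1)))) else 0 := by
    split_ifs <;> simp [stepProj_stepVar]
  cases k with
  | zero => rw [dmap_stdBasis_zero, h₁]
  | succ k =>
    rw [dmap_stdBasis_succ, map_add, map_add, map_add, h₁, add_eq_left]
    split_ifs with h
    · have h' : (k + 1) % 2 ≠ k % 2 := by omega
      simp [stepProj_stepVar, h', h.ne']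
    · simp

lemma stepProj_map_dmap_stdBasis_succ {L : List ℤ} {C : PreCx}
    (f : Msub (StdCx L) →ₗ[RUV] Msub C) (φ : Msub C →ₗ[RUV] RUV) (k : ℕ) :
    stepProj k (φ (f (dmap (StdCx L) (stdBasis L (k + 1))))) =
      if 0 < seqPad L k then
        Polynomial.X ^ (seqPad L k).natAbs * stepProj k (φ (f (stdBasis L k))) else 0 := by
  rw [dmap_stdBasis_succ, map_add, map_add, map_add]
  have h₁ : stepProj k (φ (f (if seqPad L (k + 1) < 0 then
      stepVar (k + 1) ^ (seqPad L (k + 1)).natAbs • stdBasis L (k + 2) else 0))) = 0 := by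
    split_ifs with h
    · have h' : k % 2 ≠ (k + 1) % 2 := by omega
      simp [stepProj_stepVar, h', h.ne]
    · simp
  rw [h₁, zero_add]
  split_ifs <;> simp [stepProj_stepVar]

lemma qval_lt_iff (a b : ℤ) :
    qval a < qval b ↔ (0 < b ∧ (0 < a → b < a)) ∨ (a < 0 ∧ (b < 0 → b < a)) := by
  have hq (c : ℤ) : qval c = (c : ℚ)⁻¹ := by
    unfold qval
    split_ifs with h <;> simp [h]
  rw [hq, hq]
  rcases lt_trichotomy a 0 with ha | rfl | ha <;> rcases lt_trichotomy b 0 with hb | rfl | hb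
  · have ha' : (a : ℚ) < 0 := by exact_mod_cast ha
    have hb' : (b : ℚ) < 0 := by exact_mod_cast hb
    rw [inv_lt_inv_of_neg ha' hb', Int.cast_lt]
    omega
  · have ha' : (a : ℚ) < 0 := by exact_mod_cast ha
    simp [ha]
  · have ha' : (a : ℚ)⁻¹ < 0 := inv_lt_zero.2 (by exact_mod_cast ha)
    have hb' : 0 < (b : ℚ)⁻¹ := inv_pos.2 (by exact_mod_cast hb)
    simp only [ha'.trans hb', true_iff]
    omega
  · have hb' : (b : ℚ) < 0 := by exact_mod_cast hb
    simp
  · simp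
  · simp [hb]
  · have ha' : 0 < (a : ℚ)⁻¹ := inv_pos.2 (by exact_mod_cast ha)
    have hb' : (b : ℚ)⁻¹ < 0 := inv_lt_zero.2 (by exact_mod_cast hb)
    simp only [(hb'.trans ha').not_gt, false_iff]
    omega
  · simp [ha]
  · have ha' : 0 < (a : ℚ) := by exact_mod_cast ha
    have hb' : 0 < (b : ℚ) := by exact_mod_cast hb
    rw [inv_lt_inv₀ ha' hb', Int.cast_lt]
    omega

/-- If two parameter sequences agree up to index `k`, then a map of standard complexes that
commutes with the differentials and does not vanish modulo `(U, V)` on the diagonal at `0` does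
not vanish on the diagonal at `k` either. -/
lemma coeff_zero_diagonal_eq_one {L₁ L₂ : List ℤ} (hL : IsStdSeq L₁)
    {f : Msub (StdCx L₁) →ₗ[RUV] Msub (StdCx L₂)}
    (hf : ∀ x, f (dmap (StdCx L₁) x) = dmap (StdCx L₂) (f x))
    (h₀ : (stepProj 0 (stdCoord L₂ 0 (f (stdBasis L₁ 0)))).coeff 0 = 1) {k : ℕ}
    (hk : k ≤ L₁.length) (heq : ∀ i < k, seqPad L₁ i = seqPad L₂ i) :
    (stepProj k (stdCoord L₂ k (f (stdBasis L₁ k)))).coeff 0 = 1 := by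
  induction k with
  | zero => exact h₀
  | succ k ih =>
    have ih := ih (by omega) fun i hi => heq i (by omega)
    have hne := seqPad_ne_zero hL (k := k) (by omega)
    have hX : (Polynomial.X : Polynomial (ZMod 2)) ^ (seqPad L₁ k).natAbs ≠ 0 :=
      pow_ne_zero _ Polynomial.X_ne_zero
    rw [coeff_zero_stepProj _ k, ← ih]
    congr 1
    rcases hne.lt_or_gt with h | h
    · have key := stepProj_map_dmap_stdBasis f (stdCoord L₂ (k + 1)) k
      rw [hf, stepProj_dmap_head, ← heq k (by omega), if_pos h, if_pos h] at key
      exact (mul_left_cancel₀ hX key).symm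
    · have key := stepProj_map_dmap_stdBasis_succ f (stdCoord L₂ k) k
      rw [hf, stepProj_dmap_tail, ← heq k (by omega), if_pos h, if_pos h] at key
      exact mul_left_cancel₀ hX key

lemma not_qval_lt_of_chainMap {L₁ L₂ : List ℤ} {k : ℕ}
    {f : Msub (StdCx L₁) →ₗ[RUV] Msub (StdCx L₂)}
    (hf : ∀ x, f (dmap (StdCx L₁) x) = dmap (StdCx L₂) (f x))
    (hk : (stepProj k (stdCoord L₂ k (f (stdBasis L₁ k)))).coeff 0 = 1) :
    ¬ qval (seqPad L₂ k) < qval (seqPad L₁ k) := by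
  rw [qval_lt_iff]
  rintro (⟨h, h'⟩ | ⟨h, h'⟩)
  · have key := stepProj_map_dmap_stdBasis_succ f (stdCoord L₂ k) k
    rw [hf, stepProj_dmap_tail, if_pos h] at key
    have := congr_arg (fun p => p.coeff (seqPad L₁ k).natAbs) key
    simp only [Polynomial.coeff_X_pow_mul', le_refl, if_true, Nat.sub_self, hk] at this
    split_ifs at this
    · rw [Polynomial.coeff_X_pow_mul', if_neg (by omega)] at this
      exact zero_ne_one this
    · exact zero_ne_one this
  · have key := stepProj_map_dmap_stdBasis f (stdCoord L₂ (k + 1)) k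
    rw [hf, stepProj_dmap_head, if_pos h] at key
    have := congr_arg (fun p => p.coeff (seqPad L₂ k).natAbs) key
    simp only [Polynomial.coeff_X_pow_mul', le_refl, if_true, Nat.sub_self, hk] at this
    split_ifs at this
    · rw [Polynomial.coeff_X_pow_mul', if_neg (by omega)] at this
      exact zero_ne_one this.symm
    · exact zero_ne_one this.symm

lemma le_length_of_forall_lt_eq {L₁ L₂ : List ℤ} (h₂ : IsStdSeq L₂) {k : ℕ}
    (heq : ∀ i < k, seqPad L₁ i = seqPad L₂ i) (hne : seqPad L₁ k ≠ seqPad L₂ k) :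
    k ≤ L₁.length := by
  by_contra! hk
  have h : L₂.length ≤ L₁.length := by
    by_contra! h
    exact seqPad_ne_zero h₂ h (heq _ hk ▸ seqPad_eq_zero le_rfl)
  exact hne ((seqPad_eq_zero hk.le).trans (seqPad_eq_zero (h.trans hk.le)).symm)

theorem bangLexLE_of_isLocalMap {L₁ L₂ : List ℤ} (h₁ : IsStdSeq L₁) (h₂ : IsStdSeq L₂)
    {f : Msub (StdCx L₁) →ₗ[RUV] Msub (StdCx L₂)} (hf : IsLocalMap (StdCx L₁) (StdCx L₂) f) :
    bangLexLE L₁ L₂ := by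
  by_cases h : ∀ i, seqPad L₁ i = seqPad L₂ i
  · exact .inl h
  push Not at h
  classical
  obtain ⟨k, hne, heq⟩ : ∃ k, seqPad L₁ k ≠ seqPad L₂ k ∧ ∀ i < k, seqPad L₁ i = seqPad L₂ i :=
    ⟨Nat.find h, Nat.find_spec h, fun i hi => not_not.1 (Nat.find_min h hi)⟩
  refine .inr ⟨k, heq, ?_⟩
  have hx : IsVTowerGen (StdCx L₁) (stdBasis L₁ 0) := by
    rw [isVTowerGen_stdCx_iff h₁, mem_uSub_iff]
    refine ⟨fun j => ?_, by simp [stdCoord_stdBasis]⟩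
    rw [dmap_stdBasis_zero]
    split_ifs with h
    · simp [stepProj_stepVar, h.ne]
    · simp
  have hu := ((isVTowerGen_stdCx_iff h₂ _).1 (hf.towers _ hx)).2
  have h₀ : (stepProj 0 (stdCoord L₂ 0 (f (stdBasis L₁ 0)))).coeff 0 = 1 := by
    rw [coeff_zero_stepProj _ 1]
    obtain ⟨r, hr, hr'⟩ := Polynomial.isUnit_iff.1 hu
    rw [← hr', Polynomial.coeff_C_zero]
    exact (by decide : ∀ a : ZMod 2, a ≠ 0 → a = 1) r hr.ne_zero
  have hk := coeff_zero_diagonal_eq_one h₁ hf.chain h₀ (le_length_of_forall_lt_eq h₂ heq hne) heq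
  have := not_qval_lt_of_chainMap hf.chain hk
  rw [qval_lt_iff] at this ⊢
  omega

/-- The map of standard complexes sending `x_i` to `y_i` for `i ≤ k`, `x_{k+1}` to `c y_{k+1}`,
and the remaining generators to `0`. -/
def stdMap (L₁ L₂ : List ℤ) (k : ℕ) (c : RUV) : Msub (StdCx L₁) →ₗ[RUV] Msub (StdCx L₂) :=
  Finsupp.linearCombination RUV fun i =>
    if (i : ℕ) ≤ k then stdBasis L₂ i else if (i : ℕ) = k + 1 then c • stdBasis L₂ i else 0

lemma stdMap_stdBasis (L₁ L₂ : List ℤ) (k : ℕ) (c : RUV) {i : ℕ} (hi : i ≤ L₁.length) :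
    stdMap L₁ L₂ k c (stdBasis L₁ i) =
      if i ≤ k then stdBasis L₂ i else if i = k + 1 then c • stdBasis L₂ i else 0 := by
  rw [stdBasis_val L₁ ⟨i, Nat.lt_succ_of_le hi⟩, stdMap, Finsupp.linearCombination_single, one_smul]

lemma stdMap_dmap {L₁ L₂ : List ℤ} {k : ℕ} {c : RUV}
    (heq : ∀ i < k, seqPad L₁ i = seqPad L₂ i)
    (hneg : (if seqPad L₁ k < 0 then stepVar k ^ (seqPad L₁ k).natAbs * c else 0) =
      if seqPad L₂ k < 0 then stepVar k ^ (seqPad L₂ k).natAbs else 0)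
    (hpos : (if 0 < seqPad L₁ k then stepVar k ^ (seqPad L₁ k).natAbs else 0) =
      if 0 < seqPad L₂ k then c * stepVar k ^ (seqPad L₂ k).natAbs else 0)
    (hc : c * stepVar (k + 1) = 0) (x : Msub (StdCx L₁)) :
    stdMap L₁ L₂ k c (dmap (StdCx L₁) x) = dmap (StdCx L₂) (stdMap L₁ L₂ k c x) := by
  have hc' {n : ℕ} (hn : n ≠ 0) : c * stepVar (k + 1) ^ n = 0 := by
    rw [← Nat.succ_pred_eq_of_ne_zero hn, pow_succ', ← mul_assoc, hc, zero_mul]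
  have up (i : ℕ) : stdMap L₁ L₂ k c (if seqPad L₁ i < 0 then
      stepVar i ^ (seqPad L₁ i).natAbs • stdBasis L₁ (i + 1) else 0) =
      if i ≤ k ∧ seqPad L₂ i < 0 then stepVar i ^ (seqPad L₂ i).natAbs • stdBasis L₂ (i + 1)
      else 0 := by
    rcases lt_trichotomy i k with hi | rfl | hi
    · rw [heq i hi, ← heq i hi]
      split_ifs with h₁ h₂ h₂
      · rw [map_smul, stdMap_stdBasis _ _ _ _ (lt_length_of_seqPad_ne_zero h₁.ne),
          if_pos (show i.succ ≤ k from hi)]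
      · omega
      · omega
      · simp
    · have h : stdMap L₁ L₂ i c (if seqPad L₁ i < 0 then
          stepVar i ^ (seqPad L₁ i).natAbs • stdBasis L₁ (i + 1) else 0) =
          (if seqPad L₁ i < 0 then stepVar i ^ (seqPad L₁ i).natAbs * c else 0) •
            stdBasis L₂ (i + 1) := by
        split_ifs with h
        · rw [map_smul, stdMap_stdBasis _ _ _ _ (lt_length_of_seqPad_ne_zero h.ne)]
          simp [mul_smul]
        · simp
      rw [h, hneg]
      simp [ite_smul]
    · rw [if_neg fun h : i ≤ k ∧ seqPad L₂ i < 0 => h.1.not_gt hi]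
      split_ifs with h
      · rw [map_smul, stdMap_stdBasis _ _ _ _ (lt_length_of_seqPad_ne_zero h.ne),
          if_neg (by omega), if_neg (by omega), smul_zero]
      · simp
  have down (i : ℕ) : stdMap L₁ L₂ k c (if 0 < seqPad L₁ i then
      stepVar i ^ (seqPad L₁ i).natAbs • stdBasis L₁ i else 0) =
      if i < k then (if 0 < seqPad L₂ i then
        stepVar i ^ (seqPad L₂ i).natAbs • stdBasis L₂ i else 0)
      else if i = k then (if 0 < seqPad L₂ k then
        (c * stepVar k ^ (seqPad L₂ k).natAbs) • stdBasis L₂ k else 0) else 0 := by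
    rcases lt_trichotomy i k with hi | rfl | hi
    · rw [if_pos hi, heq i hi, ← heq i hi]
      split_ifs with h
      · rw [map_smul, stdMap_stdBasis _ _ _ _ (lt_length_of_seqPad_ne_zero h.ne').le,
          if_pos hi.le]
      · simp
    · rw [if_neg (lt_irrefl _), if_pos rfl]
      have h : stdMap L₁ L₂ i c (if 0 < seqPad L₁ i then
          stepVar i ^ (seqPad L₁ i).natAbs • stdBasis L₁ i else 0) =
          (if 0 < seqPad L₁ i then stepVar i ^ (seqPad L₁ i).natAbs else 0) •
            stdBasis L₂ i := by
        split_ifs with h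
        · rw [map_smul, stdMap_stdBasis _ _ _ _ (lt_length_of_seqPad_ne_zero h.ne').le,
            if_pos le_rfl]
        · simp
      rw [h, hpos, ite_smul, zero_smul]
    · rw [if_neg hi.not_gt, if_neg hi.ne']
      split_ifs with h
      · rw [map_smul, stdMap_stdBasis _ _ _ _ (lt_length_of_seqPad_ne_zero h.ne').le,
          if_neg (by omega)]
        split_ifs with h'
        · subst h'
          rw [smul_smul, mul_comm, hc' (Int.natAbs_ne_zero.2 h.ne'), zero_smul]
        · rw [smul_zero]
      · simp
  suffices h : stdMap L₁ L₂ k c ∘ₗ dmap (StdCx L₁) = dmap (StdCx L₂) ∘ₗ stdMap L₁ L₂ k c from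
    LinearMap.congr_fun h x
  refine Finsupp.lhom_ext' fun i => LinearMap.ext_ring ?_
  simp only [LinearMap.comp_apply, Finsupp.lsingle_apply]
  rw [← stdBasis_val L₁ i, stdMap_stdBasis _ _ _ _ (Nat.lt_succ_iff.1 i.2)]
  rcases (i : ℕ) with _ | i
  · rw [dmap_stdBasis_zero, up, if_pos (Nat.zero_le _), dmap_stdBasis_zero]
    simp
  · rw [dmap_stdBasis_succ, map_add, up, down]
    rcases lt_trichotomy i k with hi | rfl | hi
    · rw [if_pos hi, if_pos (Nat.succ_le_of_lt hi), dmap_stdBasis_succ]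
      simp [Nat.succ_le_of_lt hi]
    · rw [if_neg fun h : i + 1 ≤ i ∧ seqPad L₂ (i + 1) < 0 => by omega, if_neg (lt_irrefl i),
        if_pos (rfl : i = i), if_neg (Nat.not_succ_le_self i), if_pos (rfl : i + 1 = i + 1),
        map_smul, dmap_stdBasis_succ, smul_add, smul_ite, smul_ite, smul_zero, smul_smul, smul_smul]
      congr 1
      split_ifs with h
      · rw [hc' (Int.natAbs_ne_zero.2 h.ne), zero_smul]
      · rfl
    · rw [if_neg fun h : i + 1 ≤ k ∧ seqPad L₂ (i + 1) < 0 => by omega, if_neg hi.not_gt,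
        if_neg hi.ne', if_neg (show ¬ i + 1 ≤ k by omega), if_neg (show ¬ i + 1 = k + 1 by omega),
        map_zero, add_zero]

lemma grRel_succ (L : List ℤ) (i : ℕ) :
    grRel L (i + 1) = grRel L i + stepShift i (seqPad L i) :=
  Finset.sum_range_succ _ _

lemma grRel_congr {L₁ L₂ : List ℤ} {k : ℕ} (heq : ∀ i < k, seqPad L₁ i = seqPad L₂ i) :
    grRel L₁ k = grRel L₂ k :=
  Finset.sum_congr rfl fun i hi => congr_arg (stepShift i) (heq i (Finset.mem_range.1 hi))

lemma isHomog_one : IsHomog 1 0 0 := .inr (.inl ⟨0, by simp⟩)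

lemma isHomog_stepVar_pow {k d : ℕ} {a b : ℤ} (h : stepShift k a - stepShift k b =
      if k % 2 = 0 then (-2 * (d : ℤ), 0) else (0, -2 * (d : ℤ))) :
    IsHomog (stepVar k ^ d) (stepShift k a - stepShift k b).1
      (stepShift k a - stepShift k b).2 := by
  rw [h]
  by_cases hk : k % 2 = 0
  · exact .inr (.inl ⟨d, by simp [stepVar, hk]⟩)
  · exact .inr (.inr ⟨d, by simp [stepVar, hk]⟩)

lemma stdMap_homog {L₁ L₂ : List ℤ} {k : ℕ} {c : RUV} (hk : k ≤ L₂.length)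
    (heq : ∀ i < k, seqPad L₁ i = seqPad L₂ i)
    (hc : IsHomog c (stepShift k (seqPad L₁ k) - stepShift k (seqPad L₂ k)).1
      (stepShift k (seqPad L₁ k) - stepShift k (seqPad L₂ k)).2) :
    MapHomogShift (StdCx L₁) (StdCx L₂) (stdMap L₁ L₂ k c) 0
      ((grRel L₁ L₁.length).2 - (grRel L₂ L₂.length).2) := by
  intro i j
  have gr (L : List ℤ) (i : Fin (StdCx L).n) :
      (StdCx L).gr i = ((grRel L i).1, (grRel L i).2 - (grRel L L.length).2) := rfl
  rw [← stdCoord_val L₂ j, ← stdBasis_val L₁ i, stdMap_stdBasis _ _ _ _ (Nat.lt_succ_iff.1 i.2),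
    gr, gr]
  split_ifs with h₁ h₂
  · rw [stdCoord_stdBasis L₂ (h₁.trans hk)]
    split_ifs with h
    · rw [h] at h₁ ⊢
      rw [grRel_congr fun i hi => heq i (hi.trans_le h₁)]
      convert isHomog_one using 1 <;> simp
    · exact .inl rfl
  · rw [h₂]
    by_cases h : k + 1 ≤ L₂.length
    · rw [map_smul, stdCoord_stdBasis L₂ h]
      split_ifs with hj
      · rw [← hj, grRel_succ, grRel_succ, grRel_congr heq]
        convert hc using 1
        · simp
        · simp
        · simp
      · exact .inl (by simp)
    · rw [show stdBasis L₂ (k + 1) = 0 from dif_neg (by rw [StdCx_n]; omega)]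
      exact .inl (by simp)
  · exact .inl (map_zero _)

lemma stdCoord_zero_stdMap (L₁ L₂ : List ℤ) (k : ℕ) (c : RUV) (x : Msub (StdCx L₁)) :
    stdCoord L₂ 0 (stdMap L₁ L₂ k c x) = stdCoord L₁ 0 x := by
  suffices h : stdCoord L₂ 0 ∘ₗ stdMap L₁ L₂ k c = stdCoord L₁ 0 from LinearMap.congr_fun h x
  refine Finsupp.lhom_ext' fun i => LinearMap.ext_ring ?_
  simp only [LinearMap.comp_apply, Finsupp.lsingle_apply]
  rw [← stdBasis_val L₁ i, stdMap_stdBasis _ _ _ _ (Nat.lt_succ_iff.1 i.2),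
    stdCoord_stdBasis L₁ (Nat.lt_succ_iff.1 i.2)]
  rcases (i : ℕ) with _ | i
  · simp [stdCoord_stdBasis]
  · rw [if_neg (Nat.succ_ne_zero i)]
    have h : stdCoord L₂ 0 (stdBasis L₂ (i + 1)) = 0 := by
      by_cases hi : i + 1 ≤ L₂.length
      · simp [stdCoord_stdBasis L₂ hi]
      · rw [show stdBasis L₂ (i + 1) = 0 from dif_neg (by rw [StdCx_n]; omega), map_zero]
    split_ifs <;> simp [h]

/-- The coefficient of `y_{k+1}` in the image of `x_{k+1}` under a local map between standard
complexes whose parameters first differ at index `k`, where they are `a` and `b`. -/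
lemma exists_step_coeff {a b : ℤ} (h : qval a < qval b) (k : ℕ) :
    ∃ c : RUV, (if a < 0 then stepVar k ^ a.natAbs * c else 0) =
        (if b < 0 then stepVar k ^ b.natAbs else 0) ∧
      (if 0 < a then stepVar k ^ a.natAbs else 0) =
        (if 0 < b then c * stepVar k ^ b.natAbs else 0) ∧
      c * stepVar (k + 1) = 0 ∧
      IsHomog c (stepShift k a - stepShift k b).1 (stepShift k a - stepShift k b).2 := by
  rw [qval_lt_iff] at h
  have hmul {d : ℕ} (hd : d ≠ 0) : stepVar k ^ d * stepVar (k + 1) = 0 := by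
    rw [← Nat.succ_pred_eq_of_ne_zero hd, pow_succ, mul_assoc, stepVar_mul_stepVar_succ, mul_zero]
  by_cases hneg : b < 0
  · have ha : a < 0 := by omega
    refine ⟨stepVar k ^ (b.natAbs - a.natAbs), ?_, ?_, hmul (by omega), isHomog_stepVar_pow ?_⟩
    · rw [if_pos ha, if_pos hneg, ← pow_add]
      congr 1
      omega
    · rw [if_neg (by omega), if_neg (by omega)]
    · simp only [stepShift, ha, hneg, if_true]
      split_ifs <;> simp only [Prod.mk_sub_mk, Prod.mk.injEq] <;> omega
  by_cases hpos : 0 < a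
  · have hb : 0 < b := by omega
    refine ⟨stepVar k ^ (a.natAbs - b.natAbs), ?_, ?_, hmul (by omega), isHomog_stepVar_pow ?_⟩
    · rw [if_neg (by omega), if_neg (by omega)]
    · rw [if_pos hpos, if_pos hb, ← pow_add]
      congr 1
      omega
    · simp only [stepShift, hpos.not_gt, hb.not_gt, if_false]
      split_ifs <;> simp only [Prod.mk_sub_mk, Prod.mk.injEq] <;> omega
  · exact ⟨0, by simp [hneg], by simp [hpos], zero_mul _, .inl rfl⟩

lemma eq_of_seqPad_eq {L₁ L₂ : List ℤ} (h₁ : IsStdSeq L₁) (h₂ : IsStdSeq L₂)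
    (h : ∀ i, seqPad L₁ i = seqPad L₂ i) : L₁ = L₂ := by
  refine List.ext_getElem (le_antisymm ?_ ?_) fun i hi₁ hi₂ => ?_
  · by_contra! hlt
    exact seqPad_ne_zero h₁ hlt ((h _).trans (seqPad_eq_zero le_rfl))
  · by_contra! hlt
    exact seqPad_ne_zero h₂ hlt ((h _).symm.trans (seqPad_eq_zero le_rfl))
  · have := h i
    rwa [seqPad, seqPad, List.getD_eq_getElem _ _ hi₁, List.getD_eq_getElem _ _ hi₂] at this

lemma LocalLE.refl (C : PreCx) : LocalLE C C := by
  refine ⟨LinearMap.id, fun _ => rfl, ⟨0, fun i j => ?_⟩, fun _ hx => hx⟩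
  rw [LinearMap.id_apply, Finsupp.single_apply]
  split_ifs with h
  · subst h
    simpa using isHomog_one
  · exact .inl rfl

theorem localLE_of_bangLexLE {L₁ L₂ : List ℤ} (h₁ : IsStdSeq L₁) (h₂ : IsStdSeq L₂)
    (h : bangLexLE L₁ L₂) : LocalLE (StdCx L₁) (StdCx L₂) := by
  rcases h with h | ⟨k, heq, hlt⟩
  · rw [eq_of_seqPad_eq h₁ h₂ h]
    exact .refl _
  obtain ⟨c, hneg, hpos, hc, hgr⟩ := exists_step_coeff hlt k
  have hchain := stdMap_dmap heq hneg hpos hc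
  have hne : seqPad L₂ k ≠ seqPad L₁ k := fun h => hlt.ne (congr_arg qval h.symm)
  have hk : k ≤ L₂.length := le_length_of_forall_lt_eq h₁ (fun i hi => (heq i hi).symm) hne
  refine ⟨stdMap L₁ L₂ k c, hchain, ⟨_, stdMap_homog hk heq hgr⟩, fun x hx => ?_⟩
  rw [isVTowerGen_stdCx_iff h₁] at hx
  rw [isVTowerGen_stdCx_iff h₂, stdCoord_zero_stdMap, ← hchain]
  obtain ⟨⟨y, hy⟩, hu⟩ := hx
  exact ⟨⟨stdMap L₁ L₂ k c y, by rw [← hy]; simp⟩, hu⟩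

end

/-- For standard complexes, `C(a_1, …, a_m) ≤ C(b_1, …, b_n)` (i.e.
there is a local map from the former to the latter) if and only if
`(a_1, …, a_m) ≤^! (b_1, …, b_n)` in the lexicographic order induced by `≤^!`,
padding the shorter sequence with trailing zeros. -/
theorem standard_complexes_ordered_lexicographically
    (L₁ L₂ : List ℤ) (h₁ : IsStdSeq L₁) (h₂ : IsStdSeq L₂) :
    LocalLE (StdCx L₁) (StdCx L₂) ↔ bangLexLE L₁ L₂ := by
  exact ⟨fun ⟨_, hf⟩ => bangLexLE_of_isLocalMap h₁ h₂ hf, localLE_of_bangLexLE h₁ h₂⟩
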